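/- arXiv:1809.00891 — 2 statements merged into one kernel-verified Lean document; each statement's English description precedes it below -/
import Mathlib

section
/- Let A be an M×N real matrix, β > 0, A^{-g} := (Aᵀ A + β I)⁻¹ Aᵀ, b ∈ ℝ^M, and let x₁ := A^{-g} b, x_{k+1} := x_k + A^{-g} (b − A x_k) for k ≥ 1 be the refinement iterates. Then for every k ≥ 1, x_k is the unique global minimizer over x ∈ ℝ^N of the function x ↦ ‖A x − b − Δb_{k−1}‖² + β ‖x‖², where Δb_{k−1} := Σ_{i=1}^{k−1} (b − A x_i) is the running sum of the residuals of the first k−1 iterations (Δb₀ := 0). -/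
open Matrix

/-- `AᵀA + βI` is invertible for `β > 0`. -/
theorem isUnit_det_transpose_mul_self_add_smul_one {m n : Type*} [Fintype m] [Fintype n]
    [DecidableEq n] (A : Matrix m n ℝ) {β : ℝ} (hβ : 0 < β) :
    IsUnit (Aᵀ * A + β • (1 : Matrix n n ℝ)).det := by
  have h₁ : (Aᵀ * A).PosSemidef := by
    simpa using Matrix.posSemidef_conjTranspose_mul_self A
  have h₂ : (β • (1 : Matrix n n ℝ)).PosDef := Matrix.PosDef.one.smul hβ
  exact (Matrix.PosDef.posSemidef_add h₁ h₂).det_pos.ne'.isUnit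

/-- The stabilized generalized inverse solves the regularized normal equations. -/
theorem tikhonov_normal_equations {m n : Type*} [Fintype m] [Fintype n]
    [DecidableEq n] (A : Matrix m n ℝ) {β : ℝ} (hβ : 0 < β) (c : m → ℝ) :
    Aᵀ *ᵥ (A *ᵥ (((Aᵀ * A + β • (1 : Matrix n n ℝ))⁻¹ * Aᵀ) *ᵥ c) - c) +
      β • (((Aᵀ * A + β • (1 : Matrix n n ℝ))⁻¹ * Aᵀ) *ᵥ c) = 0 := by
  have h : (Aᵀ * A + β • (1 : Matrix n n ℝ)) *ᵥ
      (((Aᵀ * A + β • (1 : Matrix n n ℝ))⁻¹ * Aᵀ) *ᵥ c) = Aᵀ *ᵥ c := by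
    rw [mulVec_mulVec, ← Matrix.mul_assoc,
      Matrix.mul_nonsing_inv _ (isUnit_det_transpose_mul_self_add_smul_one A hβ), Matrix.one_mul]
  rw [add_mulVec, smul_mulVec, one_mulVec, ← mulVec_mulVec] at h
  rw [mulVec_sub, ← h]
  abel

/-- The sum of squares of `p + q`, expanded. -/
theorem sum_add_sq_eq {ι : Type*} [Fintype ι] (p q : ι → ℝ) :
    ∑ i, ((p + q) i) ^ 2 = ∑ i, (p i) ^ 2 + ∑ i, (q i) ^ 2 + 2 * (p ⬝ᵥ q) := by
  simp only [dotProduct, Finset.mul_sum, ← Finset.sum_add_distrib, Pi.add_apply]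
  exact Finset.sum_congr rfl fun i _ => by ring

/-- The Tikhonov functional at `w` exceeds its value at a solution `u` of the normal equations
by the quadratic form of `AᵀA + βI` at `w - u`. -/
theorem tikhonov_eq_add_of_normal_equations {m n : Type*} [Fintype m] [Fintype n]
    (A : Matrix m n ℝ) (β : ℝ) (c : m → ℝ) (u : n → ℝ)
    (hu : Aᵀ *ᵥ (A *ᵥ u - c) + β • u = 0) (w : n → ℝ) :
    (∑ i, ((A *ᵥ w - c) i) ^ 2) + β * ∑ i, (w i) ^ 2 =
      ((∑ i, ((A *ᵥ u - c) i) ^ 2) + β * ∑ i, (u i) ^ 2) +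
        ((∑ i, ((A *ᵥ (w - u)) i) ^ 2) + β * ∑ i, ((w - u) i) ^ 2) := by
  have hcross : (A *ᵥ u - c) ⬝ᵥ (A *ᵥ (w - u)) + β * (u ⬝ᵥ (w - u)) = 0 := by
    have := congrArg (· ⬝ᵥ (w - u)) hu
    simpa only [add_dotProduct, smul_dotProduct, smul_eq_mul, zero_dotProduct,
      mulVec_transpose, ← dotProduct_mulVec] using this
  have hA : A *ᵥ w - c = (A *ᵥ u - c) + A *ᵥ (w - u) := by
    rw [mulVec_sub]; abel
  have h₁ := sum_add_sq_eq (A *ᵥ u - c) (A *ᵥ (w - u))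
  have h₂ := sum_add_sq_eq u (w - u)
  rw [← hA] at h₁
  rw [add_sub_cancel] at h₂
  rw [h₁, h₂]
  linear_combination 2 * hcross

/-- Iterative refinement applies `G` to the right-hand side plus all previous residuals. -/
theorem refinement_eq_mulVec_add_sum {m n : Type*} [Fintype m] [Fintype n]
    (A : Matrix m n ℝ) (G : Matrix n m ℝ) (b : m → ℝ) (x : ℕ → n → ℝ) (hx1 : x 1 = G *ᵥ b)
    (hrec : ∀ k, 1 ≤ k → x (k + 1) = x k + G *ᵥ (b - A *ᵥ x k)) (k : ℕ) (hk : 1 ≤ k) :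
    x k = G *ᵥ (b + ∑ j ∈ Finset.Icc 1 (k - 1), (b - A *ᵥ x j)) := by
  induction k, hk using Nat.le_induction with
  | base => simpa using hx1
  | succ k hk ih =>
    obtain ⟨l, rfl⟩ := Nat.exists_eq_add_of_le' hk
    rw [hrec _ hk, Nat.add_sub_cancel, Finset.sum_Icc_succ_top (by omega), ← add_assoc,
      mulVec_add]
    congr 1

/-- Each refinement iterate `x_k` is the unique global minimizer of the
Tikhonov problem `x ↦ ‖A x − b − Δb_{k−1}‖² + β ‖x‖²` whose right-hand side is updated
with the running sum `Δb_{k−1} := Σ_{i=1}^{k−1} (b − A x_i)` of previous residuals. -/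
theorem stmt_10 (M N : ℕ) (A : Matrix (Fin M) (Fin N) ℝ) (β : ℝ) (hβ : 0 < β)
    (Ag : Matrix (Fin N) (Fin M) ℝ)
    (hAg : Ag = (Aᵀ * A + β • (1 : Matrix (Fin N) (Fin N) ℝ))⁻¹ * Aᵀ)
    (b : Fin M → ℝ)
    (x : ℕ → Fin N → ℝ)
    (hx1 : x 1 = Ag *ᵥ b)
    (hrec : ∀ k, 1 ≤ k → x (k + 1) = x k + Ag *ᵥ (b - A *ᵥ x k)) :
    ∀ k, 1 ≤ k →
      (∀ w : Fin N → ℝ,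
        (∑ i, ((A *ᵥ x k - b - ∑ j ∈ Finset.Icc 1 (k - 1), (b - A *ᵥ x j)) i) ^ 2) +
            β * ∑ i, (x k i) ^ 2 ≤
        (∑ i, ((A *ᵥ w - b - ∑ j ∈ Finset.Icc 1 (k - 1), (b - A *ᵥ x j)) i) ^ 2) +
            β * ∑ i, (w i) ^ 2) ∧
      (∀ y : Fin N → ℝ,
        (∀ w : Fin N → ℝ,
          (∑ i, ((A *ᵥ y - b - ∑ j ∈ Finset.Icc 1 (k - 1), (b - A *ᵥ x j)) i) ^ 2) +
              β * ∑ i, (y i) ^ 2 ≤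
          (∑ i, ((A *ᵥ w - b - ∑ j ∈ Finset.Icc 1 (k - 1), (b - A *ᵥ x j)) i) ^ 2) +
              β * ∑ i, (w i) ^ 2) →
        y = x k) := by
  intro k hk
  set S := ∑ j ∈ Finset.Icc 1 (k - 1), (b - A *ᵥ x j) with hS
  have hxk : x k = Ag *ᵥ (b + S) := refinement_eq_mulVec_add_sum A Ag b x hx1 hrec k hk
  have hnormal : Aᵀ *ᵥ (A *ᵥ x k - (b + S)) + β • x k = 0 := by
    rw [hxk, hAg]
    exact tikhonov_normal_equations A hβ (b + S)
  have hexp := tikhonov_eq_add_of_normal_equations A β (b + S) (x k) hnormal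
  simp only [sub_sub (_ *ᵥ _) b S]
  have hnonneg (w : Fin N → ℝ) : 0 ≤ ∑ i, ((A *ᵥ (w - x k)) i) ^ 2 :=
    Finset.sum_nonneg fun i _ => sq_nonneg _
  refine ⟨fun w => ?_, fun y hy => ?_⟩
  · rw [hexp w]
    have := hnonneg w
    have : 0 ≤ β * ∑ i, ((w - x k) i) ^ 2 := by positivity
    linarith
  · have hle := hy (x k)
    rw [hexp y] at hle
    have := hnonneg y
    have hsum : 0 ≤ ∑ i, ((y - x k) i) ^ 2 := Finset.sum_nonneg fun i _ => sq_nonneg _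
    have hzero : ∑ i, ((y - x k) i) ^ 2 = 0 := by
      refine le_antisymm (nonpos_of_mul_nonpos_right ?_ hβ) hsum
      linarith
    rw [Finset.sum_eq_zero_iff_of_nonneg fun i _ => sq_nonneg _] at hzero
    funext i
    exact sub_eq_zero.mp (pow_eq_zero_iff two_ne_zero |>.mp (hzero i (Finset.mem_univ i)))
end

section
/- Let A be an invertible N×N real matrix, β > 0, A^{-g} := (Aᵀ A + β I)⁻¹ Aᵀ, b ∈ ℝ^N, and let x₁ := A^{-g} b, x_{k+1} := x_k + A^{-g} (b − A x_k) be the refinement iterates. Then the errors e_k := x_k − A⁻¹ b satisfy the exact recursion e_{k+1} = β (Aᵀ A + β I)⁻¹ e_k for every k ≥ 1. -/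
open Matrix

/-- For `A` invertible and the refinement iterates
`x₁ = A^{-g} b`, `x_{k+1} = x_k + A^{-g}(b − A x_k)` with
`A^{-g} = (Aᵀ A + β I)⁻¹ Aᵀ`, the errors `e_k := x_k − A⁻¹ b` satisfy
`e_{k+1} = β (Aᵀ A + β I)⁻¹ e_k` for every `k ≥ 1`. -/
theorem stmt_11 (N : ℕ) (A : Matrix (Fin N) (Fin N) ℝ) (hA : IsUnit A.det)
    (β : ℝ) (hβ : 0 < β)
    (Ag : Matrix (Fin N) (Fin N) ℝ)
    (hAg : Ag = (Aᵀ * A + β • (1 : Matrix (Fin N) (Fin N) ℝ))⁻¹ * Aᵀ)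
    (b : Fin N → ℝ)
    (x : ℕ → Fin N → ℝ)
    (hx1 : x 1 = Ag *ᵥ b)
    (hrec : ∀ k, 1 ≤ k → x (k + 1) = x k + Ag *ᵥ (b - A *ᵥ x k))
    (e : ℕ → Fin N → ℝ) (he : ∀ k, e k = x k - A⁻¹ *ᵥ b) :
    ∀ k, 1 ≤ k →
      e (k + 1) = β • ((Aᵀ * A + β • (1 : Matrix (Fin N) (Fin N) ℝ))⁻¹ *ᵥ e k) := by
  intro k hk
  set M := Aᵀ * A + β • (1 : Matrix (Fin N) (Fin N) ℝ) with hM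
  have hMdet : IsUnit M.det := isUnit_det_transpose_mul_self_add_smul_one A hβ
  have hresidual : b - A *ᵥ x k = -(A *ᵥ e k) := by
    rw [he, mulVec_sub, mulVec_mulVec, mul_nonsing_inv A hA, one_mulVec, neg_sub]
  have hstep : e (k + 1) = e k - (Ag * A) *ᵥ e k := by
    rw [he (k + 1), hrec k hk, hresidual, mulVec_neg, mulVec_mulVec, he k]
    abel
  have hmatrix : 1 - Ag * A = β • M⁻¹ := by
    have hAA : Aᵀ * A = M - β • 1 := by rw [hM, add_sub_cancel_right]
    rw [hAg, Matrix.mul_assoc, hAA, Matrix.mul_sub, nonsing_inv_mul M hMdet, Matrix.mul_smul,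
      Matrix.mul_one, sub_sub_cancel]
  rw [hstep, ← smul_mulVec, ← hmatrix, sub_mulVec, one_mulVec]
end
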